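/- arXiv:1908.03184 — 3 statements merged into one kernel-verified Lean document; each statement's English description precedes it below -/
import Mathlib

section
/- Fix natural numbers D ≥ 1 and N ≥ 1. Let R = ℚ[λ_{u,v} : u ∈ Fin D, v ∈ Fin N] be a polynomial ring, and in R[w,t] set Σ = ∏_{u∈Fin D} ( w − ∏_{v∈Fin N} (t − λ_{u,v}) ). For 0 ≤ i ≤ D and 0 ≤ j ≤ N·i, define σ_{i,j} ∈ R by σ_{i,j} = (−1)^{i+j} · (the coefficient of w^{D−i} t^{N·i−j} in Σ); interpret σ_{k,j} = 0 when j > N·k. Then for all i, j with 1 ≤ j < i ≤ D, the element σ_{i,j} lies in the ℚ-linear span of the set {σ_{1,j}, σ_{2,j}, …, σ_{j,j}} inside R. -/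
open MvPolynomial

/-- `Σ = ∏_{u ∈ Fin D} (w - ∏_{v ∈ Fin N} (t - λ_{u,v}))`, as a polynomial in the two
variables `w = X 0`, `t = X 1` over `R = ℚ[λ_{u,v}]`. -/
noncomputable def SigmaPoly (D N : ℕ) :
    MvPolynomial (Fin 2) (MvPolynomial (Fin D × Fin N) ℚ) :=
  ∏ u : Fin D, (X 0 - ∏ v : Fin N, (X 1 - C (X (u, v))))

/-- The multiplier invariant `σ_{i,j} = (-1)^(i+j) ·` (coefficient of
`w^(D-i) t^(N·i-j)` in `Σ`), interpreted as `0` when `j > N·i`. -/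
noncomputable def sigmaInv (D N i j : ℕ) : MvPolynomial (Fin D × Fin N) ℚ :=
  if j ≤ N * i then
    (-1) ^ (i + j) *
      MvPolynomial.coeff (Finsupp.single 0 (D - i) + Finsupp.single 1 (N * i - j))
        (SigmaPoly D N)
  else 0

section ElementarySymmetric

variable {ι S : Type*} [Fintype ι] [CommRing S]

/-- The `i`-th elementary symmetric function of a finite family of ring elements. -/
def elemSymm (q : ι → S) (i : ℕ) : S :=
  ∑ A ∈ Finset.powersetCard i Finset.univ, ∏ u ∈ A, q u

lemma elemSymm_zero (q : ι → S) : elemSymm q 0 = 1 := by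
  simp [elemSymm]

lemma coeff_prod_X_add_C_eq_elemSymm (q : ι → S) {i : ℕ} (hi : i ≤ Fintype.card ι) :
    (∏ u, (Polynomial.X + Polynomial.C (q u))).coeff (Fintype.card ι - i) = elemSymm q i := by
  rw [Finset.prod_X_add_C_coeff _ _ (by simp), Finset.card_univ, Nat.sub_sub_self hi, elemSymm]

lemma elemSymm_neg (q : ι → S) (i : ℕ) :
    elemSymm (fun u => -q u) i = (-1) ^ i * elemSymm q i := by
  rw [elemSymm, elemSymm, Finset.mul_sum]
  refine Finset.sum_congr rfl fun A hA => ?_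
  rw [Finset.prod_neg, (Finset.mem_powersetCard.mp hA).2]

/-- Translating all members of a family by a rational constant changes the `i`-th elementary
symmetric function into a rational combination of those of index at most `i`. -/
lemma exists_elemSymm_add_algebraMap [Algebra ℚ S] (q : ι → S) (a : ℚ) {i : ℕ}
    (hi : i ≤ Fintype.card ι) :
    ∃ c : ℕ → ℚ, elemSymm (fun u => q u + algebraMap ℚ S a) i =
      ∑ k ∈ Finset.range (i + 1), c k • elemSymm q k := by
  classical
  set d := Fintype.card ι with hd
  set p : Polynomial S := ∏ u, (Polynomial.X + Polynomial.C (q u)) with hp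
  have hcomp : ∏ u, (Polynomial.X + Polynomial.C (q u + algebraMap ℚ S a)) =
      p.comp (Polynomial.X + Polynomial.C (algebraMap ℚ S a)) := by
    rw [hp, Polynomial.prod_comp]
    refine Finset.prod_congr rfl fun u _ => ?_
    simp only [Polynomial.add_comp, Polynomial.X_comp, Polynomial.C_comp, Polynomial.C_add]
    ring
  have hdeg : p.natDegree < d + 1 := by
    refine Nat.lt_succ_of_le ((Polynomial.natDegree_prod_le _ _).trans ?_)
    refine (Finset.sum_le_card_nsmul _ _ 1 fun u _ => ?_).trans (by simp [hd])
    exact (Polynomial.natDegree_add_C).trans_le Polynomial.natDegree_X_le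
  refine ⟨fun k => a ^ (i - k) * ((d - k).choose (d - i) : ℚ), ?_⟩
  rw [← coeff_prod_X_add_C_eq_elemSymm _ hi, hcomp, Polynomial.comp,
    Polynomial.eval₂_eq_sum_range' _ hdeg, Polynomial.finsetSum_coeff,
    ← Finset.sum_range_reflect]
  have hsub : Finset.range (i + 1) ⊆ Finset.range (d + 1) :=
    Finset.range_subset_range.mpr (by omega)
  rw [← Finset.sum_subset hsub]
  · refine Finset.sum_congr rfl fun k hk => ?_
    have hk' : k ≤ i := Nat.lt_succ_iff.mp (Finset.mem_range.mp hk)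
    have h1 : d + 1 - 1 - k = d - k := by omega
    have h2 : d - k - (d - i) = i - k := by omega
    rw [h1, Polynomial.coeff_C_mul, Polynomial.coeff_X_add_C_pow, h2,
      coeff_prod_X_add_C_eq_elemSymm _ (hk'.trans hi), Algebra.smul_def]
    simp only [map_mul, map_pow, map_natCast]
    ring
  · intro k hk hk'
    have h3 : i < k ∧ k ≤ d := by
      simp only [Finset.mem_range] at hk hk'
      omega
    rw [Polynomial.coeff_C_mul, Polynomial.coeff_X_add_C_pow,
      Nat.choose_eq_zero_of_lt (by omega)]
    simp

end ElementarySymmetric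

/-- For `j ≥ 1`, the coefficient of `X ^ j` kills the elementary symmetric function of index `0`,
so translating a family by a constant stays in the span of the coefficients of positive index. -/
lemma coeff_elemSymm_add_mem_span {ι A : Type*} [Fintype ι] [CommRing A] [Algebra ℚ A]
    (q : ι → Polynomial A) (a : ℚ) {i j : ℕ} (hj : 1 ≤ j) (hi : i ≤ Fintype.card ι) :
    (elemSymm (fun u => q u + algebraMap ℚ (Polynomial A) a) i).coeff j ∈
      Submodule.span ℚ ((fun k => (elemSymm q k).coeff j) '' Set.Icc 1 i) := by
  obtain ⟨c, hc⟩ := exists_elemSymm_add_algebraMap q a hi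
  rw [hc, Polynomial.finsetSum_coeff]
  refine Submodule.sum_mem _ fun k hk => ?_
  rw [Polynomial.coeff_smul]
  refine Submodule.smul_mem _ _ ?_
  rcases Nat.eq_zero_or_pos k with rfl | hk0
  · rw [elemSymm_zero, Polynomial.coeff_one, if_neg (by omega)]
    exact Submodule.zero_mem _
  · exact Submodule.subset_span ⟨k, ⟨hk0, Nat.lt_succ_iff.mp (Finset.mem_range.mp hk)⟩, rfl⟩

lemma coeff_elemSymm_eq_zero {ι A : Type*} [Fintype ι] [CommRing A] (q : ι → Polynomial A)
    (hq : ∀ u, (q u).coeff 0 = 0) {k j : ℕ} (hjk : j < k) : (elemSymm q k).coeff j = 0 := by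
  refine Polynomial.X_pow_dvd_iff.mp (Finset.dvd_sum fun A hA => ?_) j hjk
  rw [← (Finset.mem_powersetCard.mp hA).2, ← Finset.prod_const]
  exact Finset.prod_dvd_prod_of_dvd _ _ fun u _ => Polynomial.X_dvd_iff.mpr (hq u)

/-- If every member of a family of polynomials has constant coefficient `1`, the `j`-th coefficients
of its elementary symmetric functions all lie in the span of those of index `1, …, j`. -/
lemma coeff_elemSymm_mem_span {ι A : Type*} [Fintype ι] [CommRing A] [Algebra ℚ A]
    (q : ι → Polynomial A) (hq : ∀ u, (q u).coeff 0 = 1) {i j : ℕ} (hj : 1 ≤ j)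
    (hi : i ≤ Fintype.card ι) :
    (elemSymm q i).coeff j ∈
      Submodule.span ℚ ((fun k => (elemSymm q k).coeff j) '' Set.Icc 1 j) := by
  set r : ι → Polynomial A := fun u => q u + algebraMap ℚ (Polynomial A) (-1) with hr
  have hr0 : ∀ u, (r u).coeff 0 = 0 := fun u => by simp [hr, hq]
  have hqr : q = fun u => r u + algebraMap ℚ (Polynomial A) 1 := by
    funext u
    simp [hr]
  have hmem := coeff_elemSymm_add_mem_span r 1 hj hi
  rw [← hqr] at hmem
  refine Submodule.span_le.mpr ?_ hmem
  rintro _ ⟨k, ⟨hk1, hki⟩, rfl⟩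
  rcases lt_or_ge j k with hjk | hkj
  · simp only [coeff_elemSymm_eq_zero r hr0 hjk]
    exact Submodule.zero_mem _
  · exact Submodule.span_mono (Set.image_mono (Set.Icc_subset_Icc_right hkj))
      (coeff_elemSymm_add_mem_span q (-1) hj (hki.trans hi))

/-- Polynomials in `X 0, X 1` viewed as polynomials in `X 0` over polynomials in `X 1`. -/
noncomputable def iteratedPolynomial (A : Type*) [CommRing A] :
    MvPolynomial (Fin 2) A →ₐ[A] Polynomial (Polynomial A) :=
  aeval ![Polynomial.X, Polynomial.C Polynomial.X]

lemma coeff_iteratedPolynomial {A : Type*} [CommRing A] (f : MvPolynomial (Fin 2) A) (a b : ℕ) :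
    ((iteratedPolynomial A f).coeff a).coeff b =
      f.coeff (Finsupp.single 0 a + Finsupp.single 1 b) := by
  induction f using MvPolynomial.induction_on' with
  | monomial m r =>
    have hm : m = Finsupp.single 0 a + Finsupp.single 1 b ↔ m 0 = a ∧ m 1 = b := by
      constructor
      · rintro rfl
        simp
      · rintro ⟨rfl, rfl⟩
        ext x
        fin_cases x <;> simp
    have hr : algebraMap A (Polynomial (Polynomial A)) r = Polynomial.C (Polynomial.C r) := rfl
    rw [iteratedPolynomial, aeval_monomial, Finsupp.prod_fintype _ _ (by simp), Fin.prod_univ_two,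
      MvPolynomial.coeff_monomial, hr]
    simp only [hm, Matrix.cons_val_zero, Matrix.cons_val_one]
    rw [mul_left_comm, ← Polynomial.C_pow, ← Polynomial.C_mul, mul_comm,
      Polynomial.coeff_C_mul_X_pow]
    by_cases h0 : m 0 = a
    · by_cases h1 : m 1 = b
      · simp [h0, h1]
      · simp [h0, h1, Polynomial.coeff_X_pow, Ne.symm h1]
    · simp [h0, Ne.symm h0]
  | add p q hp hq => simp [hp, hq]

/-- The multiplier polynomial `∏_v (t - λ_{u,v})` at the `u`-th point. -/
noncomputable def multiplierPoly (D N : ℕ) (u : Fin D) :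
    Polynomial (MvPolynomial (Fin D × Fin N) ℚ) :=
  ∏ v : Fin N, (Polynomial.X - Polynomial.C (X (u, v)))

lemma multiplierPoly_monic (D N : ℕ) (u : Fin D) : (multiplierPoly D N u).Monic :=
  Polynomial.monic_prod_X_sub_C _ _

lemma natDegree_multiplierPoly (D N : ℕ) (u : Fin D) : (multiplierPoly D N u).natDegree = N := by
  simp [multiplierPoly]

lemma iteratedPolynomial_SigmaPoly (D N : ℕ) :
    iteratedPolynomial _ (SigmaPoly D N) =
      ∏ u, (Polynomial.X + Polynomial.C (-multiplierPoly D N u)) := by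
  have hC : ∀ r : MvPolynomial (Fin D × Fin N) ℚ,
      iteratedPolynomial _ (C r) = Polynomial.C (Polynomial.C r) := fun r => by
    rw [iteratedPolynomial, aeval_C]
    rfl
  have h0 : iteratedPolynomial (MvPolynomial (Fin D × Fin N) ℚ) (X 0) = Polynomial.X := by
    simp [iteratedPolynomial]
  have h1 : iteratedPolynomial (MvPolynomial (Fin D × Fin N) ℚ) (X 1) =
      Polynomial.C Polynomial.X := by
    simp [iteratedPolynomial]
  simp only [SigmaPoly, multiplierPoly, map_prod, map_sub, map_neg, hC, h0, h1, ← sub_eq_add_neg]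

lemma reverse_prod_multiplierPoly (D N : ℕ) (A : Finset (Fin D)) :
    (∏ u ∈ A, multiplierPoly D N u).reverse = ∏ u ∈ A, (multiplierPoly D N u).reverse := by
  classical
  induction A using Finset.induction_on with
  | empty => simpa using Polynomial.reverse_C (1 : MvPolynomial (Fin D × Fin N) ℚ)
  | insert u A hu ih =>
    rw [Finset.prod_insert hu, Finset.prod_insert hu, Polynomial.reverse_mul_of_domain, ih]

lemma sigmaInv_eq_coeff_elemSymm (D N i j : ℕ) (hi : i ≤ D) :
    sigmaInv D N i j =
      (-1) ^ j * (elemSymm (fun u => (multiplierPoly D N u).reverse) i).coeff j := by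
  have hcoeff : ∀ A ∈ Finset.powersetCard i (Finset.univ : Finset (Fin D)),
      (∏ u ∈ A, (multiplierPoly D N u).reverse).coeff j =
        if j ≤ N * i then (∏ u ∈ A, multiplierPoly D N u).coeff (N * i - j) else 0 := by
    intro A hA
    have hdeg : (∏ u ∈ A, multiplierPoly D N u).natDegree = N * i := by
      rw [Polynomial.natDegree_prod_of_monic _ _ fun u _ => multiplierPoly_monic D N u]
      simp [natDegree_multiplierPoly, (Finset.mem_powersetCard.mp hA).2, mul_comm]
    rw [← reverse_prod_multiplierPoly, Polynomial.coeff_reverse, hdeg]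
    split_ifs with h
    · rw [Polynomial.revAt_le h]
    · rw [Polynomial.revAt_eq_self_of_lt (not_le.mp h)]
      exact Polynomial.coeff_eq_zero_of_natDegree_lt (hdeg.trans_lt (not_le.mp h))
  have hsum : (elemSymm (fun u => (multiplierPoly D N u).reverse) i).coeff j =
      if j ≤ N * i then (elemSymm (multiplierPoly D N) i).coeff (N * i - j) else 0 := by
    rw [elemSymm, elemSymm, Polynomial.finsetSum_coeff, Polynomial.finsetSum_coeff,
      Finset.sum_congr rfl hcoeff]
    split_ifs <;> simp
  rw [sigmaInv, hsum]
  split_ifs with h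
  · have hE := coeff_prod_X_add_C_eq_elemSymm (fun u => -multiplierPoly D N u)
      (i := i) (by simpa using hi)
    rw [Fintype.card_fin] at hE
    have hsign : ((-1) ^ i : Polynomial (MvPolynomial (Fin D × Fin N) ℚ)) =
        Polynomial.C ((-1) ^ i) := by simp
    rw [← coeff_iteratedPolynomial, iteratedPolynomial_SigmaPoly, hE, elemSymm_neg, hsign,
      Polynomial.coeff_C_mul, pow_add]
    have hsq : ((-1) ^ i * (-1) ^ i : MvPolynomial (Fin D × Fin N) ℚ) = 1 := by
      simp [← mul_pow]
    linear_combination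
      (-1) ^ j * (elemSymm (multiplierPoly D N) i).coeff (N * i - j) * hsq
  · simp

/-- For `1 ≤ j < i ≤ D`, the invariant `σ_{i,j}` lies in the ℚ-linear span of
`{σ_{1,j}, …, σ_{j,j}}`. -/
theorem sigmaInv_mem_span (D N : ℕ) (hD : 1 ≤ D) (hN : 1 ≤ N)
    (i j : ℕ) (hj : 1 ≤ j) (hji : j < i) (hiD : i ≤ D) :
    sigmaInv D N i j ∈
      Submodule.span ℚ ((fun k => sigmaInv D N k j) '' (Set.Icc 1 j)) := by
  have hspan := coeff_elemSymm_mem_span (fun u => (multiplierPoly D N u).reverse)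
    (fun u => by rw [Polynomial.coeff_zero_reverse]; exact multiplierPoly_monic D N u)
    hj (i := i) (by simpa using hiD)
  have hsmul : ∀ k ≤ D, sigmaInv D N k j =
      ((-1) ^ j : ℚ) • (elemSymm (fun u => (multiplierPoly D N u).reverse) k).coeff j := by
    intro k hk
    rw [sigmaInv_eq_coeff_elemSymm D N k j hk, Algebra.smul_def]
    simp
  rw [hsmul i hiD]
  refine Submodule.smul_mem _ _ (Submodule.span_le.mpr ?_ hspan)
  rintro _ ⟨k, hk, rfl⟩
  have hmem : sigmaInv D N k j ∈
      Submodule.span ℚ ((fun k => sigmaInv D N k j) '' Set.Icc 1 j) :=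
    Submodule.subset_span ⟨k, hk, rfl⟩
  rw [hsmul k (hk.2.trans (hji.le.trans hiD))] at hmem
  exact (Submodule.smul_mem_iff _ (by simp)).mp hmem
end

section
/- Let K be a field, N a natural number, and d ≥ 1. For each j ∈ Fin (N+1), let f j be a polynomial in MvPolynomial (Fin (N+1)) K that is homogeneous of degree d. Suppose a : Fin (N+1) → K and c ∈ K satisfy eval a (f j) = c * a j for every j ∈ Fin (N+1). Let J be the (N+1)×(N+1) Jacobian matrix with entries J j l = eval a (pderiv l (f j)). Then J.mulVec a = (d·c) • a. Consequently, if a ≠ 0, then d·c is an eigenvalue of the Jacobian matrix J. -/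
/-- Euler's identity at a fixed point: if `f` is a tuple of degree-`d` homogeneous
polynomials with `eval a (f j) = c * a j` for all `j`, then the Jacobian matrix `J`
satisfies `J.mulVec a = (d·c) • a`; hence if `a ≠ 0` then `d·c` is an eigenvalue
of `J`. -/
theorem jacobian_eigenvalue_at_fixed_point
    {K : Type*} [Field K] (N d : ℕ) (hd : 1 ≤ d)
    (f : Fin (N + 1) → MvPolynomial (Fin (N + 1)) K)
    (hf : ∀ j, (f j).IsHomogeneous d)
    (a : Fin (N + 1) → K) (c : K)
    (hfix : ∀ j, MvPolynomial.eval a (f j) = c * a j)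
    (J : Matrix (Fin (N + 1)) (Fin (N + 1)) K)
    (hJ : ∀ j l, J j l = MvPolynomial.eval a (MvPolynomial.pderiv l (f j))) :
    J.mulVec a = ((d : K) * c) • a ∧
      (a ≠ 0 → Module.End.HasEigenvalue (Matrix.toLin' J) ((d : K) * c)) := by
  have hmul : J.mulVec a = ((d : K) * c) • a := by
    ext j
    have h := congrArg (MvPolynomial.eval a) (hf j).sum_X_mul_pderiv
    simp only [map_sum, map_mul, MvPolynomial.eval_X, map_natCast, hfix, nsmul_eq_mul] at h
    simp only [Matrix.mulVec, dotProduct, hJ, Pi.smul_apply, smul_eq_mul, mul_assoc, ← h]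
    exact Finset.sum_congr rfl fun l _ => mul_comm _ _
  refine ⟨hmul, fun ha => Module.End.hasEigenvalue_of_hasEigenvector (x := a) ?_⟩
  exact ⟨Module.End.mem_eigenspace_iff.2 (by rw [Matrix.toLin'_apply, hmul]), ha⟩
end

section
/- In the polynomial ring ℚ[a₁,a₂,b₁,b₂], define: p₁ = 8a₂b₁ + 4; p₂ = −2a₁² − 4a₁b₁ + 36a₂b₁ − 4a₂b₂ − 2b₂² − 4a₁ + 4a₂ − 4b₁ + 4b₂ + 60; p₃ = 8a₁²b₁ + 16a₁a₂b₁ + 16a₂b₁b₂ + 8a₂b₂² − 4a₁² + 8a₁b₁ + 40a₂b₁ − 24a₂b₂ − 4b₂² − 8a₁ + 16a₂ + 8b₂ + 24; p₄ = −4a₁³b₁ + 18a₂²b₁² − 8a₁a₂b₁b₂ − 2a₁²b₂² − 4a₂b₂³ − 4a₁²b₁ + 24a₁a₂b₁ + 4a₁²b₂ + 8a₂b₁b₂ − 4a₁b₂² + 20a₂b₂² − 4a₁² + 20a₂b₁ + 8a₁b₂ − 32a₂b₂ − 4b₂² − 8a₁ + 16a₂ + 8b₂; p₅ = 32a₁²b₁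 + 64a₁a₂b₁ − 8a₂²b₁ − 8a₂b₁² + 64a₂b₁b₂ + 32a₂b₂² − 32a₁² + 128a₂b₁ − 128a₂b₂ − 32b₂² − 64a₁ + 96a₂ − 32b₁ + 64b₂ + 176. Let H(s₁,s₂,s₃,s₄,s₅) = 36s₁⁵ − 18s₁⁴s₂ + 2s₁³s₂² + 17712s₁⁴ − 8384s₁³s₂ + 1292s₁²s₂² − 64s₁s₂³ − 2456s₁³s₃ + 476s₁²s₂s₃ + 73s₁²s₃² + 16s₁s₂s₃² + 16s₁³s₄ + 792s₁³s₅ − 196s₁²s₂s₅ + 8s₁s₂²s₅ − 54s₁²s₃s₅ − 4s₁s₂s₃s₅ + 9s₁²s₅² + 197280s₁³ − 105984s₁²s₂ + 22464s₁s₂² − 1792s₂³ + 48256s₁²s₃ − 12064s₁s₂s₃ − 11336s₁s₃² + 1472s₂s₃² + 512s₃³ − 51392s₁²s₄ + 20480s₁s₂s₄ − 2048s₂²s₄ + 10240s₁s₃s₄ − 2048s₂s₃s₄ − 512s₃²s₄ + 3008s₁²s₅ − 2400s₁s₂s₅ + 480s₂²s₅ + 2992s₁s₃s₅ − 240s₂s₃s₅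 − 256s₃²s₅ − 2560s₁s₄s₅ + 512s₂s₄s₅ + 256s₃s₄s₅ − 40s₁s₅² − 32s₂s₅² + 32s₃s₅² − 32s₄s₅² + 2411904s₁² − 1307136s₁s₂ + 171968s₂² + 268416s₁s₃ + 16064s₂s₃ − 38768s₃² − 613632s₁s₄ + 122880s₂s₄ + 61440s₃s₄ + 85376s₁s₅ − 32320s₂s₅ + 4768s₃s₅ − 15360s₄s₅ + 1232s₅² + 20517376s₁ − 5436928s₂ − 459776s₃ − 1844224s₄ + 532480s₅ + 56702976. Then substituting s₁ = p₁, s₂ = p₂, s₃ = p₃, s₄ = p₄, s₅ = p₅ yields the zero polynomial: H(p₁,p₂,p₃,p₄,p₅) = 0 in ℚ[a₁,a₂,b₁,b₂]. Equivalently, for all rational values of a₁,a₂,b₁,b₂, the point (p₁,p₂,p₃,p₄,p₅) lies on the hypersurface {H = 0} in 𝔸⁵. -/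
open MvPolynomial

namespace MonicPolyMultipliers

noncomputable def a₁ : MvPolynomial (Fin 4) ℚ := X 0
noncomputable def a₂ : MvPolynomial (Fin 4) ℚ := X 1
noncomputable def b₁ : MvPolynomial (Fin 4) ℚ := X 2
noncomputable def b₂ : MvPolynomial (Fin 4) ℚ := X 3

/-- `σ_{1,2}` for the monic quadratic family. -/
noncomputable def p₁ : MvPolynomial (Fin 4) ℚ := 8*a₂*b₁ + 4

/-- `σ_{2,2}` for the monic quadratic family. -/
noncomputable def p₂ : MvPolynomial (Fin 4) ℚ :=
  -2*a₁^2 - 4*a₁*b₁ + 36*a₂*b₁ - 4*a₂*b₂ - 2*b₂^2 - 4*a₁ + 4*a₂ - 4*b₁ + 4*b₂ + 60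

/-- `σ_{2,3}` for the monic quadratic family. -/
noncomputable def p₃ : MvPolynomial (Fin 4) ℚ :=
  8*a₁^2*b₁ + 16*a₁*a₂*b₁ + 16*a₂*b₁*b₂ + 8*a₂*b₂^2 - 4*a₁^2 + 8*a₁*b₁ + 40*a₂*b₁
    - 24*a₂*b₂ - 4*b₂^2 - 8*a₁ + 16*a₂ + 8*b₂ + 24

/-- `σ_{2,4}` for the monic quadratic family. -/
noncomputable def p₄ : MvPolynomial (Fin 4) ℚ :=
  -4*a₁^3*b₁ + 18*a₂^2*b₁^2 - 8*a₁*a₂*b₁*b₂ - 2*a₁^2*b₂^2 - 4*a₂*b₂^3 - 4*a₁^2*b₁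
    + 24*a₁*a₂*b₁ + 4*a₁^2*b₂ + 8*a₂*b₁*b₂ - 4*a₁*b₂^2 + 20*a₂*b₂^2 - 4*a₁^2
    + 20*a₂*b₁ + 8*a₁*b₂ - 32*a₂*b₂ - 4*b₂^2 - 8*a₁ + 16*a₂ + 8*b₂

/-- `σ_{3,3}` for the monic quadratic family. -/
noncomputable def p₅ : MvPolynomial (Fin 4) ℚ :=
  32*a₁^2*b₁ + 64*a₁*a₂*b₁ - 8*a₂^2*b₁ - 8*a₂*b₁^2 + 64*a₂*b₁*b₂ + 32*a₂*b₂^2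
    - 32*a₁^2 + 128*a₂*b₁ - 128*a₂*b₂ - 32*b₂^2 - 64*a₁ + 96*a₂ - 32*b₁ + 64*b₂ + 176

/-- The hypersurface polynomial cutting out the image of `τ_{2,1}²` restricted to
monic quadratic polynomial endomorphisms of `ℙ²`. -/
noncomputable def H (s₁ s₂ s₃ s₄ s₅ : MvPolynomial (Fin 4) ℚ) : MvPolynomial (Fin 4) ℚ :=
  36*s₁^5 - 18*s₁^4*s₂ + 2*s₁^3*s₂^2 + 17712*s₁^4 - 8384*s₁^3*s₂ + 1292*s₁^2*s₂^2
    - 64*s₁*s₂^3 - 2456*s₁^3*s₃ + 476*s₁^2*s₂*s₃ + 73*s₁^2*s₃^2 + 16*s₁*s₂*s₃^2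
    + 16*s₁^3*s₄ + 792*s₁^3*s₅ - 196*s₁^2*s₂*s₅ + 8*s₁*s₂^2*s₅ - 54*s₁^2*s₃*s₅
    - 4*s₁*s₂*s₃*s₅ + 9*s₁^2*s₅^2 + 197280*s₁^3 - 105984*s₁^2*s₂ + 22464*s₁*s₂^2
    - 1792*s₂^3 + 48256*s₁^2*s₃ - 12064*s₁*s₂*s₃ - 11336*s₁*s₃^2 + 1472*s₂*s₃^2
    + 512*s₃^3 - 51392*s₁^2*s₄ + 20480*s₁*s₂*s₄ - 2048*s₂^2*s₄ + 10240*s₁*s₃*s₄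
    - 2048*s₂*s₃*s₄ - 512*s₃^2*s₄ + 3008*s₁^2*s₅ - 2400*s₁*s₂*s₅ + 480*s₂^2*s₅
    + 2992*s₁*s₃*s₅ - 240*s₂*s₃*s₅ - 256*s₃^2*s₅ - 2560*s₁*s₄*s₅ + 512*s₂*s₄*s₅
    + 256*s₃*s₄*s₅ - 40*s₁*s₅^2 - 32*s₂*s₅^2 + 32*s₃*s₅^2 - 32*s₄*s₅^2
    + 2411904*s₁^2 - 1307136*s₁*s₂ + 171968*s₂^2 + 268416*s₁*s₃ + 16064*s₂*s₃
    - 38768*s₃^2 - 613632*s₁*s₄ + 122880*s₂*s₄ + 61440*s₃*s₄ + 85376*s₁*s₅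
    - 32320*s₂*s₅ + 4768*s₃*s₅ - 15360*s₄*s₅ + 1232*s₅^2 + 20517376*s₁
    - 5436928*s₂ - 459776*s₃ - 1844224*s₄ + 532480*s₅ + 56702976

/-- In coordinates where each `sᵢ` is an affine shift of a simpler invariant, `H` has only
five terms. -/
theorem H_affine_change (u q r m d : MvPolynomial (Fin 4) ℚ) :
    H (8*u + 4) (36*u - 2*q + 64) (8*r - 4*q + 40*u + 32)
      (18*u^2 + 12*u + 8*r - 2*q - 2*m + 6) (32*r - 32*q + 128*u - 8*d + 240) =
    4096*(d^2*m - u*d*q*r + u^2*r^2 + u^3*q^2 - 4*u^3*m) := by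
  simp only [H]
  ring

/-- The relation among the simplified invariants, in terms of `x = a₁ + 1` and `w = b₂ - 1`. -/
theorem simplified_invariants_relation {R : Type*} [CommRing R] (x y z w : R) {q r m : R}
    (hq : q = x^2 + w^2 + 2*(z*x + y*w))
    (hr : r = z*x^2 + y*w^2 + 2*(y*z)*(x + w))
    (hm : m = x^2*w^2 + 4*(y*z)*(x*w) + 2*(z*x^3 + y*w^3)) :
    (y + z)^2*m - (y + z)*q*r + r^2 + y*z*q^2 - 4*(y*z)*m = 0 := by
  subst hq hr hm
  ring

/-- The multiplier invariants of the monic quadratic family lie on the hypersurface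
`{H = 0}`: substituting `s₁ = p₁, …, s₅ = p₅` yields the zero polynomial. -/
theorem multipliers_on_hypersurface : H p₁ p₂ p₃ p₄ p₅ = 0 := by
  obtain ⟨q, hq⟩ : ∃ q, q = (a₁ + 1)^2 + (b₂ - 1)^2 + 2*(b₁*(a₁ + 1) + a₂*(b₂ - 1)) := ⟨_, rfl⟩
  obtain ⟨r, hr⟩ : ∃ r, r = b₁*(a₁ + 1)^2 + a₂*(b₂ - 1)^2
      + 2*(a₂*b₁)*((a₁ + 1) + (b₂ - 1)) := ⟨_, rfl⟩
  obtain ⟨m, hm⟩ : ∃ m, m = (a₁ + 1)^2*(b₂ - 1)^2 + 4*(a₂*b₁)*((a₁ + 1)*(b₂ - 1))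
      + 2*(b₁*(a₁ + 1)^3 + a₂*(b₂ - 1)^3) := ⟨_, rfl⟩
  have h₁ : p₁ = 8*(a₂*b₁) + 4 := by rw [p₁]; ring
  have h₂ : p₂ = 36*(a₂*b₁) - 2*q + 64 := by rw [p₂, hq]; ring
  have h₃ : p₃ = 8*r - 4*q + 40*(a₂*b₁) + 32 := by rw [p₃, hq, hr]; ring
  have h₄ : p₄ = 18*(a₂*b₁)^2 + 12*(a₂*b₁) + 8*r - 2*q - 2*m + 6 := by
    rw [p₄, hq, hr, hm]; ring
  have h₅ : p₅ = 32*r - 32*q + 128*(a₂*b₁) - 8*(a₂*b₁*(a₂ + b₁)) + 240 := by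
    rw [p₅, hq, hr]; ring
  rw [h₁, h₂, h₃, h₄, h₅, H_affine_change]
  linear_combination 4096*(a₂*b₁)^2*simplified_invariants_relation _ _ _ _ hq hr hm

end MonicPolyMultipliers
end
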